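/- For any isometric immersion of a Riemannian n-manifold M into Euclidean m-space 𝔼^m and for any k-tuple (n₁,…,n_k) of integers ≥ 2 with n₁ < n and n₁+⋯+n_k ≤ n, the inequality δ(n₁,…,n_k) ≤ c(n₁,…,n_k) H² holds at every point of M, where H = |H⃗| is the mean curvature and c(n₁,…,n_k) = n²(n+k−1−Σⱼ nⱼ)/(2(n+k−Σⱼ nⱼ)). -/

import Mathlib

noncomputable section

open scoped RealInnerProductSpace BigOperators

/-- We identify the tangent space at each point of a Riemannian `n`-manifold with
the Euclidean space `ℝⁿ` (via a choice of orthonormal frame). -/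
abbrev EucSp (n : ℕ) := EuclideanSpace ℝ (Fin n)

/-- The data of a Riemannian `n`-manifold recorded through the quantities entering
Chen's theory of `δ`-invariants: the underlying topological space together with,
at each point, the Riemann curvature tensor expressed in an orthonormal frame, so
that for orthonormal vectors `u, v` the number `R p u v u v` is the sectional
curvature `K(u ∧ v)` of the plane spanned by `u` and `v` at `p`. -/
structure GeomData (n : ℕ) where
  /-- the underlying set of points -/
  M : Type
  /-- the underlying topology -/
  [top : TopologicalSpace M]
  /-- the Riemann curvature tensor (in orthonormal frames) -/
  R : M → EucSp n → EucSp n → EucSp n → EucSp n → ℝ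

attribute [instance] GeomData.top

/-- A Riemannian manifold together with its Laplace–Beltrami operator `Δ`
acting on (smooth) real valued functions. -/
structure RiemannData (n : ℕ) extends GeomData n where
  /-- the Laplace–Beltrami operator -/
  lap : (M → ℝ) → (M → ℝ)

variable {n : ℕ}

/-- The scalar curvature `τ(L) = ∑_{α<β} K(e_α ∧ e_β)` of a subspace
`L ⊆ T_pM`, computed with respect to an orthonormal basis `e_1, …, e_r` of `L`. -/
def GeomData.subScal (X : GeomData n) (p : X.M) (L : Submodule ℝ (EucSp n)) : ℝ :=
  ∑ i : Fin (Module.finrank ℝ L), ∑ j : Fin (Module.finrank ℝ L),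
    if (i : ℕ) < (j : ℕ) then
      X.R p (stdOrthonormalBasis ℝ L i : EucSp n) (stdOrthonormalBasis ℝ L j : EucSp n)
        (stdOrthonormalBasis ℝ L i : EucSp n) (stdOrthonormalBasis ℝ L j : EucSp n)
    else 0

/-- The scalar curvature `τ(p) = ∑_{i<j} K(e_i ∧ e_j)` at a point `p`. -/
def GeomData.scal (X : GeomData n) (p : X.M) : ℝ :=
  X.subScal p ⊤

/-- An admissible tuple `(n₁, …, n_k)` in Chen's set `𝒮(n)`: an (unordered) tuple
of integers `≥ 2`, each `< n`, with `n₁ + ⋯ + n_k ≤ n`.  The empty tuple (`k = 0`),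
corresponding to the trivial invariant `δ(∅) = τ`, is allowed. -/
structure ChenTuple (n : ℕ) where
  /-- the length of the tuple -/
  k : ℕ
  /-- the entries `n₁, …, n_k` -/
  nn : Fin k → ℕ
  two_le : ∀ j, 2 ≤ nn j
  lt_n : ∀ j, nn j < n
  sum_le : ∑ j, nn j ≤ n

/-- The normalizing constant
`c(n₁,…,n_k) = n²(n + k - 1 - ∑ n_j) / (2(n + k - ∑ n_j))`. -/
def ChenTuple.c {n : ℕ} (t : ChenTuple n) : ℝ :=
  ((n : ℝ) ^ 2 * ((n : ℝ) + (t.k : ℝ) - 1 - ∑ j, (t.nn j : ℝ))) /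
    (2 * ((n : ℝ) + (t.k : ℝ) - ∑ j, (t.nn j : ℝ)))

/-- A family of subspaces of the tangent space is mutually orthogonal if vectors
belonging to different members are orthogonal. -/
def MutuallyOrthogonal {n k : ℕ} (L : Fin k → Submodule ℝ (EucSp n)) : Prop :=
  ∀ i j, i ≠ j → ∀ u ∈ L i, ∀ v ∈ L j, ⟪u, v⟫ = 0

/-- Chen's `δ`-invariant
`δ(n₁,…,n_k)(p) = τ(p) - inf { τ(L₁) + ⋯ + τ(L_k) }`, the infimum being taken
over all families of mutually orthogonal subspaces `L₁, …, L_k` of `T_pM` with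
`dim L_j = n_j`. -/
def GeomData.delta (X : GeomData n) (t : ChenTuple n) (p : X.M) : ℝ :=
  X.scal p - sInf { s : ℝ |
    ∃ L : Fin t.k → Submodule ℝ (EucSp n),
      (∀ j, Module.finrank ℝ (L j) = t.nn j) ∧
      MutuallyOrthogonal L ∧
      s = ∑ j, X.subScal p (L j) }

/-- The maximal normalized `δ`-invariant
`Δ̂₀(M)(p) = max { δ(n₁,…,n_k)(p) / c(n₁,…,n_k) : (n₁,…,n_k) ∈ 𝒮(n) }`. -/
def GeomData.Delta0 (X : GeomData n) (p : X.M) : ℝ :=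
  sSup { r : ℝ | ∃ t : ChenTuple n, r = X.delta t p / t.c }

/-- An isometric immersion of the Riemannian `n`-manifold `X` into the Euclidean
`m`-space `𝔼^m`, recorded through its underlying (continuous) map `x` and its
second fundamental form `h` --- a symmetric bilinear map at each point, expressed
in orthonormal frames --- which is tied to the intrinsic curvature of `X` by the
equation of Gauss for submanifolds of Euclidean space. -/
structure IsometricImmersion (m : ℕ) {n : ℕ} (X : GeomData n) where
  /-- the underlying map into `𝔼^m` -/
  x : X.M → EucSp m
  continuous_x : Continuous x
  /-- the second fundamental form -/
  h : X.M → EucSp n →ₗ[ℝ] EucSp n →ₗ[ℝ] EucSp m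
  h_symm : ∀ p u v, h p u v = h p v u
  /-- the equation of Gauss (for a Euclidean ambient space): it expresses that
  `x` is an isometric immersion with second fundamental form `h`. -/
  gauss : ∀ p u v w z,
    X.R p u v w z = ⟪h p u w, h p v z⟫ - ⟪h p u z, h p v w⟫

/-- The mean curvature vector `H⃗ = (1/n) trace h` of an isometric immersion. -/
def IsometricImmersion.meanCurvVec {m : ℕ} {X : GeomData n}
    (ι : IsometricImmersion m X) (p : X.M) : EucSp m :=
  (n : ℝ)⁻¹ • ∑ i, ι.h p (EuclideanSpace.basisFun (Fin n) ℝ i)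
      (EuclideanSpace.basisFun (Fin n) ℝ i)

/-- An isometric immersion is *ideal* if its squared mean curvature satisfies
`H² = Δ̂₀(M)` identically. -/
def IsometricImmersion.IsIdeal {m : ℕ} {X : GeomData n}
    (ι : IsometricImmersion m X) : Prop :=
  ∀ p, ‖ι.meanCurvVec p‖ ^ 2 = X.Delta0 p

/-- `μ` is an eigenvalue of the Laplace–Beltrami operator of `X` if it has a
nonzero (continuous) eigenfunction. -/
def RiemannData.IsEigenvalue (X : RiemannData n) (μ : ℝ) : Prop :=
  ∃ f : X.M → ℝ, Continuous f ∧ f ≠ 0 ∧ X.lap f = μ • f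

/-- The first positive eigenvalue `λ₁` of the Laplace–Beltrami operator. -/
def RiemannData.lambda1 (X : RiemannData n) : ℝ :=
  sInf { μ : ℝ | 0 < μ ∧ X.IsEigenvalue μ }

/-- A Riemannian covering map `π : X → Y`: a topological covering map which is a
local isometry.  Its differential at each point is a linear isometry between
tangent spaces (expressed in the orthonormal frames) which intertwines the
curvature tensors, and lifting functions along `π` intertwines the
Laplace–Beltrami operators. -/
structure RiemannianCovering (X Y : RiemannData n) where
  /-- the underlying covering map -/
  π : X.M → Y.M
  covering : IsCoveringMap π
  /-- the differential of `π` (a linear isometry, since `π` is a local isometry) -/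
  d : X.M → (EucSp n ≃ₗᵢ[ℝ] EucSp n)
  compat_R : ∀ p u v w z,
    Y.R (π p) (d p u) (d p v) (d p w) (d p z) = X.R p u v w z
  compat_lap : ∀ f : Y.M → ℝ, X.lap (f ∘ π) = (Y.lap f) ∘ π

/-- An isometry of the Riemannian manifold `X`: a homeomorphism whose
differential at each point is a linear isometry of tangent spaces intertwining
the curvature tensor, and which commutes with the Laplace–Beltrami operator. -/
structure IsomData (X : RiemannData n) where
  /-- the underlying homeomorphism -/
  toHomeomorph : X.M ≃ₜ X.M
  /-- the differential -/
  d : X.M → (EucSp n ≃ₗᵢ[ℝ] EucSp n)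
  compat_R : ∀ p u v w z,
    X.R (toHomeomorph p) (d p u) (d p v) (d p w) (d p z) = X.R p u v w z
  compat_lap : ∀ f : X.M → ℝ, X.lap (f ∘ toHomeomorph) = (X.lap f) ∘ toHomeomorph

/-- A Riemannian manifold is homogeneous if its group of isometries acts
transitively. -/
def IsHomogeneous (X : RiemannData n) : Prop :=
  ∀ p q : X.M, ∃ φ : IsomData X, φ.toHomeomorph p = q

/-- A Riemannian manifold has irreducible isotropy action if, at every point `p`,
the only subspaces of the tangent space `T_pM` invariant under the differentials
of all isometries fixing `p` are `0` and `T_pM`. -/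
def HasIrreducibleIsotropy (X : RiemannData n) : Prop :=
  ∀ p : X.M, ∀ W : Submodule ℝ (EucSp n),
    (∀ φ : IsomData X, φ.toHomeomorph p = p →
      W.map ((φ.d p).toLinearEquiv : EucSp n →ₗ[ℝ] EucSp n) = W) →
    W = ⊥ ∨ W = ⊤

/-- A Riemannian manifold has constant sectional curvature one iff its curvature
tensor is `R(u,v,w,z) = ⟪u,w⟫⟪v,z⟫ - ⟪u,z⟫⟪v,w⟫`. -/
def ConstantCurvatureOne (X : GeomData n) : Prop :=
  ∀ p u v w z, X.R p u v w z = ⟪u, w⟫ * ⟪v, z⟫ - ⟪u, z⟫ * ⟪v, w⟫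

/-- A symmetric array vanishing on the diagonal sums to twice its strictly upper triangular part. -/
theorem two_mul_sum_lt_of_symm {r : ℕ} (f : Fin r → Fin r → ℝ) (hf : ∀ i j, f i j = f j i)
    (h0 : ∀ i, f i i = 0) :
    2 * ∑ i : Fin r, ∑ j : Fin r, (if (i : ℕ) < (j : ℕ) then f i j else 0) =
      ∑ i, ∑ j, f i j := by
  have hswap : ∑ i : Fin r, ∑ j : Fin r, (if (i : ℕ) < (j : ℕ) then f i j else 0) =
      ∑ i : Fin r, ∑ j : Fin r, (if (j : ℕ) < (i : ℕ) then f i j else 0) := by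
    rw [Finset.sum_comm]
    simp only [fun i j => hf j i]
  rw [two_mul]
  nth_rewrite 2 [hswap]
  simp only [← Finset.sum_add_distrib]
  refine Finset.sum_congr rfl fun i _ => Finset.sum_congr rfl fun j _ => ?_
  rcases lt_trichotomy (i : ℕ) (j : ℕ) with h | h | h
  · simp [h, h.not_gt]
  · obtain rfl := Fin.ext h
    simp [h0]
  · simp [h, h.not_gt]

section Trace

variable {E F κ κ' : Type*} [NormedAddCommGroup E] [InnerProductSpace ℝ E]
  [NormedAddCommGroup F] [InnerProductSpace ℝ F] [Fintype κ] [Fintype κ']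

/-- The trace of a bilinear map does not depend on the orthonormal basis. -/
theorem OrthonormalBasis.sum_bilin_self_eq {G : Type*} [AddCommGroup G] [Module ℝ G]
    (b : OrthonormalBasis κ ℝ E) (c : OrthonormalBasis κ' ℝ E) (B : E →ₗ[ℝ] E →ₗ[ℝ] G) :
    ∑ i, B (b i) (b i) = ∑ k, B (c k) (c k) := by
  calc ∑ i, B (b i) (b i) = ∑ i, B (∑ k, ⟪c k, b i⟫ • c k) (b i) := by
        simp only [c.sum_repr']
    _ = ∑ k, B (c k) (∑ i, ⟪b i, c k⟫ • b i) := by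
        simp only [map_sum, map_smul, LinearMap.sum_apply, LinearMap.smul_apply]
        rw [Finset.sum_comm]
        simp only [real_inner_comm]
    _ = _ := by simp only [b.sum_repr']

/-- The Hilbert–Schmidt norm of a symmetric bilinear map does not depend on the orthonormal
basis. -/
theorem OrthonormalBasis.sum_norm_sq_bilin_eq
    (b : OrthonormalBasis κ ℝ E) (c : OrthonormalBasis κ' ℝ E) (B : E →ₗ[ℝ] E →ₗ[ℝ] F)
    (hB : ∀ u v, B u v = B v u) :
    ∑ i, ∑ j, ‖B (b i) (b j)‖ ^ 2 = ∑ i, ∑ j, ‖B (c i) (c j)‖ ^ 2 := by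
  have key (u : E) : ∑ j, ‖B u (b j)‖ ^ 2 = ∑ j, ‖B u (c j)‖ ^ 2 := by
    simpa using b.sum_bilin_self_eq c ((innerₗ F).compl₁₂ (B u) (B u))
  simp only [key]
  rw [Finset.sum_comm]
  simp only [fun i j => hB (b i) (c j), key]

end Trace

/-- The Gauss equation for the scalar curvature of a subspace. -/
theorem IsometricImmersion.two_mul_subScal {m n : ℕ} {X : GeomData n}
    (ι : IsometricImmersion m X) (p : X.M) (L : Submodule ℝ (EucSp n)) :
    2 * X.subScal p L =
      ‖∑ i, ι.h p (stdOrthonormalBasis ℝ L i) (stdOrthonormalBasis ℝ L i)‖ ^ 2 -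
        ∑ i, ∑ j, ‖ι.h p (stdOrthonormalBasis ℝ L i) (stdOrthonormalBasis ℝ L j)‖ ^ 2 := by
  have hR (u v : EucSp n) :
      X.R p u v u v = ⟪ι.h p u u, ι.h p v v⟫ - ‖ι.h p u v‖ ^ 2 := by
    rw [ι.gauss, ι.h_symm p v u, real_inner_self_eq_norm_sq]
  rw [GeomData.subScal, two_mul_sum_lt_of_symm
    (fun i j => X.R p (stdOrthonormalBasis ℝ L i : EucSp n) (stdOrthonormalBasis ℝ L j : EucSp n)
        (stdOrthonormalBasis ℝ L i : EucSp n) (stdOrthonormalBasis ℝ L j : EucSp n))]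
  · simp only [hR, Finset.sum_sub_distrib]
    rw [← real_inner_self_eq_norm_sq, sum_inner]
    simp only [inner_sum]
  · intro i j
    simp only [hR]
    rw [real_inner_comm, ι.h_symm p (stdOrthonormalBasis ℝ L i : EucSp n)
      (stdOrthonormalBasis ℝ L j : EucSp n)]
  · intro i
    rw [hR, real_inner_self_eq_norm_sq, sub_self]

/-- The Gauss equation for the scalar curvature, in an arbitrary orthonormal basis. -/
theorem IsometricImmersion.two_mul_scal {m n : ℕ} {X : GeomData n}
    (ι : IsometricImmersion m X) (p : X.M) {κ : Type*} [Fintype κ]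
    (b : OrthonormalBasis κ ℝ (EucSp n)) :
    2 * X.scal p = ‖∑ i, ι.h p (b i) (b i)‖ ^ 2 - ∑ i, ∑ j, ‖ι.h p (b i) (b j)‖ ^ 2 := by
  let c : OrthonormalBasis _ ℝ (EucSp n) :=
    (stdOrthonormalBasis ℝ (⊤ : Submodule ℝ (EucSp n))).map (LinearIsometryEquiv.ofTop _ _ rfl)
  have hc (i) : c i = (stdOrthonormalBasis ℝ (⊤ : Submodule ℝ (EucSp n)) i : EucSp n) := rfl
  rw [GeomData.scal, ι.two_mul_subScal, b.sum_bilin_self_eq c,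
    b.sum_norm_sq_bilin_eq c _ (ι.h_symm p)]
  simp only [hc]

/-- There are mutually orthogonal subspaces of prescribed dimensions with sum at most `n`. -/
theorem exists_mutuallyOrthogonal_finrank {n k : ℕ} (d : Fin k → ℕ) (hd : ∑ j, d j ≤ n) :
    ∃ L : Fin k → Submodule ℝ (EucSp n),
      (∀ j, Module.finrank ℝ (L j) = d j) ∧ MutuallyOrthogonal L := by
  obtain ⟨e⟩ : Nonempty ((Σ j, Fin (d j)) ↪ Fin n) :=
    Function.Embedding.nonempty_of_card_le (by simpa using hd)
  have ho := (EuclideanSpace.basisFun (Fin n) ℝ).orthonormal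
  refine ⟨fun j => Submodule.span ℝ
    (Set.range fun i => EuclideanSpace.basisFun (Fin n) ℝ (e ⟨j, i⟩)), fun j => ?_, ?_⟩
  · have hinj : Function.Injective fun i : Fin (d j) => e ⟨j, i⟩ :=
      e.injective.comp sigma_mk_injective
    simpa [Function.comp_def] using finrank_span_eq_card (ho.linearIndependent.comp _ hinj)
  · intro i j hij
    rw [← Submodule.isOrtho_iff_inner_eq, Submodule.isOrtho_span]
    rintro _ ⟨a, rfl⟩ _ ⟨b, rfl⟩
    refine ho.2 fun h => hij ?_
    exact congrArg Sigma.fst (e.injective h)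

/-- Mutually orthogonal subspaces have an adapted orthonormal basis of the whole space. -/
theorem MutuallyOrthogonal.exists_adapted_basis {n k : ℕ} {L : Fin k → Submodule ℝ (EucSp n)}
    (hL : MutuallyOrthogonal L) (hn : ∑ j, Module.finrank ℝ (L j) ≤ n) :
    ∃ b : OrthonormalBasis
        ((Σ j, Fin (Module.finrank ℝ (L j))) ⊕ Fin (n - ∑ j, Module.finrank ℝ (L j))) ℝ (EucSp n),
      ∀ j i, b (.inl ⟨j, i⟩) = (stdOrthonormalBasis ℝ (L j) i : EucSp n) := by
  let v : (Σ j, Fin (Module.finrank ℝ (L j))) ⊕ Fin (n - ∑ j, Module.finrank ℝ (L j)) → EucSp n :=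
    Sum.elim (fun a => (stdOrthonormalBasis ℝ (L a.1) a.2 : EucSp n)) 0
  have hv : Orthonormal ℝ ((Set.range Sum.inl).domRestrict v) := by
    constructor
    · rintro ⟨_, ⟨j, i⟩, rfl⟩
      exact (stdOrthonormalBasis ℝ (L j)).orthonormal.1 i
    · rintro ⟨_, ⟨j, i⟩, rfl⟩ ⟨_, ⟨j', i'⟩, rfl⟩ hne
      by_cases hj : j = j'
      · subst hj
        refine (stdOrthonormalBasis ℝ (L j)).orthonormal.2 (i := i) (j := i') ?_
        rintro rfl
        exact hne rfl
      · exact hL j j' hj _ (Submodule.coe_mem _) _ (Submodule.coe_mem _)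
  obtain ⟨b, hb⟩ := hv.exists_orthonormalBasis_extension_of_card_eq (by simp [hn])
  exact ⟨b, fun j i => hb _ ⟨_, rfl⟩⟩

/-- The algebraic inequality behind Chen's: for an array split into `k` diagonal blocks and `r`
further indices, Cauchy–Schwarz on the `k + r` partial traces bounds the total trace. -/
theorem norm_sq_trace_le_of_blocks {F : Type*} [NormedAddCommGroup F] [InnerProductSpace ℝ F]
    {k r : ℕ} {d : Fin k → ℕ}
    (a : (Σ j, Fin (d j)) ⊕ Fin r → (Σ j, Fin (d j)) ⊕ Fin r → F) :
    ‖∑ x, a x x‖ ^ 2 ≤ (k + r) *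
      (∑ j, ‖∑ i, a (.inl ⟨j, i⟩) (.inl ⟨j, i⟩)‖ ^ 2 + ∑ x, ∑ y, ‖a x y‖ ^ 2 -
        ∑ j, ∑ i, ∑ i', ‖a (.inl ⟨j, i⟩) (.inl ⟨j, i'⟩)‖ ^ 2) := by
  let w : Fin k ⊕ Fin r → F :=
    Sum.elim (fun j => ∑ i, a (.inl ⟨j, i⟩) (.inl ⟨j, i⟩)) fun s => a (.inr s) (.inr s)
  have hw : ∑ x, a x x = ∑ z, w z := by
    simp [w, Fintype.sum_sum_type, Fintype.sum_sigma]
  have hcs : ‖∑ z, w z‖ ^ 2 ≤ (k + r) * ∑ z, ‖w z‖ ^ 2 :=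
    calc ‖∑ z, w z‖ ^ 2 ≤ (∑ z, ‖w z‖) ^ 2 := by gcongr; exact norm_sum_le _ _
      _ ≤ _ := by
        simpa using sq_sum_le_card_mul_sum_sq (s := Finset.univ) (f := fun z => ‖w z‖)
  have hblock : ∑ j, ∑ i, ∑ i', ‖a (.inl ⟨j, i⟩) (.inl ⟨j, i'⟩)‖ ^ 2 ≤
      ∑ x, ∑ y, ‖a (.inl x) (.inl y)‖ ^ 2 := by
    simp only [Fintype.sum_sigma]
    refine Finset.sum_le_sum fun j _ => Finset.sum_le_sum fun i _ => ?_
    exact Finset.single_le_sum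
      (f := fun j' => ∑ i', ‖a (.inl ⟨j, i⟩) (.inl ⟨j', i'⟩)‖ ^ 2)
      (fun _ _ => by positivity) (Finset.mem_univ j)
  have hdiag : ∑ s, ‖a (.inr s) (.inr s)‖ ^ 2 ≤ ∑ s, ∑ s', ‖a (.inr s) (.inr s')‖ ^ 2 :=
    Finset.sum_le_sum fun s _ => Finset.single_le_sum
      (f := fun s' => ‖a (.inr s) (.inr s')‖ ^ 2) (fun _ _ => by positivity) (Finset.mem_univ s)
  have hoff : 0 ≤ ∑ x, ∑ s, ‖a (.inl x) (.inr s)‖ ^ 2 := by positivity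
  have hoff' : 0 ≤ ∑ s, ∑ x, ‖a (.inr s) (.inl x)‖ ^ 2 := by positivity
  rw [hw]
  refine hcs.trans ?_
  gcongr
  rw [Fintype.sum_sum_type]
  simp only [w, Sum.elim_inl, Sum.elim_inr]
  rw [Fintype.sum_sum_type (f := fun x => ∑ y, ‖a x y‖ ^ 2)]
  simp only [Fintype.sum_sum_type, Finset.sum_add_distrib]
  linarith

/-- The trace of the second fundamental form is `n` times the mean curvature vector. -/
theorem IsometricImmersion.sq_mul_norm_sq_meanCurvVec {m n : ℕ} {X : GeomData n}
    (ι : IsometricImmersion m X) (p : X.M) {κ : Type*} [Fintype κ]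
    (b : OrthonormalBasis κ ℝ (EucSp n)) :
    (n : ℝ) ^ 2 * ‖ι.meanCurvVec p‖ ^ 2 = ‖∑ x, ι.h p (b x) (b x)‖ ^ 2 := by
  rw [b.sum_bilin_self_eq (EuclideanSpace.basisFun (Fin n) ℝ), IsometricImmersion.meanCurvVec,
    norm_smul, mul_pow, ← mul_assoc]
  rcases eq_or_ne n 0 with rfl | h0
  · simp
  · have : (n : ℝ) ≠ 0 := by exact_mod_cast h0
    simp [this]

/-- The scalar curvature is bounded by the squared norm of the trace of the second fundamental
form. -/
theorem IsometricImmersion.two_mul_scal_le {m n : ℕ} {X : GeomData n}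
    (ι : IsometricImmersion m X) (p : X.M) :
    2 * X.scal p ≤ (n : ℝ) ^ 2 * ‖ι.meanCurvVec p‖ ^ 2 := by
  rw [ι.two_mul_scal p (EuclideanSpace.basisFun (Fin n) ℝ),
    ι.sq_mul_norm_sq_meanCurvVec p (EuclideanSpace.basisFun (Fin n) ℝ)]
  exact sub_le_self _ (Finset.sum_nonneg fun _ _ => Finset.sum_nonneg fun _ _ => sq_nonneg _)

/-- Chen's inequality for a fixed family of mutually orthogonal subspaces, with denominators
cleared. -/
theorem IsometricImmersion.scal_sub_sum_subScal_le {m n k : ℕ} {X : GeomData n}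
    (ι : IsometricImmersion m X) (p : X.M) {L : Fin k → Submodule ℝ (EucSp n)}
    (hL : MutuallyOrthogonal L) {d : Fin k → ℕ} (hd : ∀ j, Module.finrank ℝ (L j) = d j)
    (hn : ∑ j, d j ≤ n) :
    (X.scal p - ∑ j, X.subScal p (L j)) * (2 * (n + k - ∑ j, (d j : ℝ))) ≤
      (n : ℝ) ^ 2 * (n + k - 1 - ∑ j, (d j : ℝ)) * ‖ι.meanCurvVec p‖ ^ 2 := by
  obtain rfl : (fun j => Module.finrank ℝ (L j)) = d := funext hd
  obtain ⟨b, hb⟩ := hL.exists_adapted_basis hn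
  have hscal := ι.two_mul_scal p b
  have hsub := Finset.sum_congr rfl fun j (_ : j ∈ Finset.univ) => ι.two_mul_subScal p (L j)
  rw [← Finset.mul_sum, Finset.sum_sub_distrib] at hsub
  have hcs := norm_sq_trace_le_of_blocks fun x y => ι.h p (b x) (b y)
  simp only [hb] at hcs
  rw [← ι.sq_mul_norm_sq_meanCurvVec p b] at hcs hscal
  rw [Nat.cast_sub hn, Nat.cast_sum] at hcs
  generalize (∑ x, ∑ y, ‖ι.h p (b x) (b y)‖ ^ 2) = P at hcs hscal
  generalize ∑ j, (Module.finrank ℝ (L j) : ℝ) = D at hcs ⊢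
  linear_combination hcs + (n + k - D) * (hscal - hsub)

/-- **Chen's fundamental inequality.** For any isometric immersion of a
Riemannian `n`-manifold `M` into Euclidean `m`-space `𝔼^m` and any admissible
tuple `(n₁,…,n_k)` (integers `≥ 2` with `n₁ < n` and `n₁ + ⋯ + n_k ≤ n`), one
has `δ(n₁,…,n_k) ≤ c(n₁,…,n_k) H²` at every point, where `H` is the mean
curvature and `c(n₁,…,n_k) = n²(n + k - 1 - ∑ nⱼ)/(2(n + k - ∑ nⱼ))`. -/
theorem chen_fundamental_inequality {n m : ℕ} (X : GeomData n)
    (ι : IsometricImmersion m X) (t : ChenTuple n) (p : X.M) :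
    X.delta t p ≤ t.c * ‖ι.meanCurvVec p‖ ^ 2 := by
  rw [GeomData.delta, sub_le_comm]
  refine le_csInf ?_ ?_
  · obtain ⟨L, hd, hL⟩ := exists_mutuallyOrthogonal_finrank t.nn t.sum_le
    exact ⟨_, L, hd, hL, rfl⟩
  rintro _ ⟨L, hd, hL, rfl⟩
  rw [sub_le_comm, ChenTuple.c, div_mul_eq_mul_div]
  have hmain := ι.scal_sub_sum_subScal_le p hL hd t.sum_le
  have hsum : ∑ j, (t.nn j : ℝ) ≤ n := by exact_mod_cast t.sum_le
  rcases t.k.eq_zero_or_pos with hk | hk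
  · have : IsEmpty (Fin t.k) := by rw [hk]; infer_instance
    rcases n.eq_zero_or_pos with rfl | hn
    · have := ι.two_mul_scal_le p
      simp_all
      linarith
    · rw [le_div_iff₀ (by simp [hk, hn])]
      exact hmain
  · have : (0 : ℝ) < t.k := by exact_mod_cast hk
    rw [le_div_iff₀ (by linarith)]
    exact hmain
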